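/- Let Ω and Ω_j (j ∈ ℕ) be nonempty bounded open subsets of ℝⁿ (n ≥ 2) of finite perimeter. If χ_{Ω_j} → χ_Ω in L¹(ℝⁿ) and P(Ω_j) → P(Ω) as j → ∞, then h(Ω_j) → h(Ω) as j → ∞. -/

import Mathlib

open MeasureTheory Metric Set Filter
open scoped ENNReal NNReal Topology Pointwise

noncomputable section

/-- The divergence of a vector field on `ℝⁿ`. -/
def divergence {n : ℕ} (g : EuclideanSpace ℝ (Fin n) → EuclideanSpace ℝ (Fin n))
    (x : EuclideanSpace ℝ (Fin n)) : ℝ :=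
  LinearMap.trace ℝ (EuclideanSpace ℝ (Fin n)) (fderiv ℝ g x).toLinearMap

/-- The (distributional) perimeter of a set `F ⊆ ℝⁿ`:
`P(F) = sup {∫_F div g : g ∈ C¹_c(ℝⁿ;ℝⁿ), ‖g‖ ≤ 1}`. -/
def perimeter {n : ℕ} (F : Set (EuclideanSpace ℝ (Fin n))) : ℝ≥0∞ :=
  ⨆ g ∈ {g : EuclideanSpace ℝ (Fin n) → EuclideanSpace ℝ (Fin n) |
      ContDiff ℝ 1 g ∧ HasCompactSupport g ∧ ∀ x, ‖g x‖ ≤ 1},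
    ENNReal.ofReal (∫ x in F, divergence g x)

/-- The Cheeger constant of `Ω`:
`h(Ω) = inf {P(F) / |F| : F ⊆ Ω Borel, |F| > 0}`. -/
def cheegerConstant {n : ℕ} (Ω : Set (EuclideanSpace ℝ (Fin n))) : ℝ≥0∞ :=
  ⨅ F ∈ {F : Set (EuclideanSpace ℝ (Fin n)) | MeasurableSet F ∧ F ⊆ Ω ∧ 0 < volume F},
    perimeter F / volume F

/-- `F` is a Cheeger set in `Ω`: a Borel subset of `Ω` of positive volume
whose ratio `P(F)/|F|` attains the Cheeger constant of `Ω`. -/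
def IsCheegerSet {n : ℕ} (Ω F : Set (EuclideanSpace ℝ (Fin n))) : Prop :=
  MeasurableSet F ∧ F ⊆ Ω ∧ 0 < volume F ∧ perimeter F / volume F = cheegerConstant Ω

/-- The trace as a continuous linear functional on endomorphisms of `ℝⁿ`. -/
def traceCLM (n : ℕ) :
    (EuclideanSpace ℝ (Fin n) →L[ℝ] EuclideanSpace ℝ (Fin n)) →L[ℝ] ℝ :=
  LinearMap.toContinuousLinearMap
    ((LinearMap.trace ℝ (EuclideanSpace ℝ (Fin n))).comp (ContinuousLinearMap.coeLM ℝ))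

theorem divergence_eq_traceCLM {n : ℕ} (g : EuclideanSpace ℝ (Fin n) → EuclideanSpace ℝ (Fin n))
    (x : EuclideanSpace ℝ (Fin n)) : divergence g x = traceCLM n (fderiv ℝ g x) := rfl

/-- The admissible vector fields of class `C¹` with compact support and norm at most `1`. -/
def IsTestField {n : ℕ} (g : EuclideanSpace ℝ (Fin n) → EuclideanSpace ℝ (Fin n)) : Prop :=
  ContDiff ℝ 1 g ∧ HasCompactSupport g ∧ ∀ x, ‖g x‖ ≤ 1

section Divergence

variable {n : ℕ} {g h : EuclideanSpace ℝ (Fin n) → EuclideanSpace ℝ (Fin n)}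

theorem continuous_divergence (hg : ContDiff ℝ 1 g) : Continuous (divergence g) :=
  (traceCLM n).continuous.comp (hg.continuous_fderiv one_ne_zero)

theorem hasCompactSupport_divergence (hg : HasCompactSupport g) :
    HasCompactSupport (divergence g) :=
  (hg.fderiv (𝕜 := ℝ)).comp_left (map_zero (traceCLM n))

theorem integrable_divergence (hg : ContDiff ℝ 1 g) (hc : HasCompactSupport g) :
    Integrable (divergence g) :=
  (continuous_divergence hg).integrable_of_hasCompactSupport (hasCompactSupport_divergence hc)

theorem divergence_add {x : EuclideanSpace ℝ (Fin n)} (hg : DifferentiableAt ℝ g x)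
    (hh : DifferentiableAt ℝ h x) :
    divergence (fun y => g y + h y) x = divergence g x + divergence h x := by
  simp only [divergence_eq_traceCLM, fderiv_fun_add hg hh, map_add]

theorem divergence_sub {x : EuclideanSpace ℝ (Fin n)} (hg : DifferentiableAt ℝ g x)
    (hh : DifferentiableAt ℝ h x) :
    divergence (fun y => g y - h y) x = divergence g x - divergence h x := by
  simp only [divergence_eq_traceCLM, fderiv_fun_sub hg hh, map_sub]

theorem divergence_smul {w : EuclideanSpace ℝ (Fin n) → ℝ} {x : EuclideanSpace ℝ (Fin n)}
    (hw : DifferentiableAt ℝ w x) (hg : DifferentiableAt ℝ g x) :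
    divergence (fun y => w y • g y) x = w x * divergence g x + fderiv ℝ w x (g x) := by
  rw [divergence_eq_traceCLM, fderiv_fun_smul hw hg, map_add, map_smul, smul_eq_mul,
    ← divergence_eq_traceCLM]
  congr 1
  exact LinearMap.trace_smulRight (fderiv ℝ w x).toLinearMap (g x)

theorem divergence_comp_add_right (y x : EuclideanSpace ℝ (Fin n)) :
    divergence (fun z => g (z + y)) x = divergence g (x + y) := by
  simp only [divergence_eq_traceCLM, fderiv_comp_add_right]

theorem integral_divergence_eq_zero (hg : ContDiff ℝ 1 g) (hc : HasCompactSupport g) :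
    ∫ x, divergence g x = 0 := by
  have hi : Integrable (fderiv ℝ g) :=
    (hg.continuous_fderiv one_ne_zero).integrable_of_hasCompactSupport (hc.fderiv (𝕜 := ℝ))
  have h0 : ∫ x, fderiv ℝ g x = 0 := by
    ext1 v
    rw [ContinuousLinearMap.integral_apply hi]
    have := integral_smul_fderiv_eq_neg_fderiv_smul_of_integrable (𝕜 := ℝ) (μ := volume)
      (f := fun _ : EuclideanSpace ℝ (Fin n) => (1 : ℝ)) (g := g) (v := v)
      (by simp) (by simpa using hi.apply_continuousLinearMap v)
      (by simpa using hg.continuous.integrable_of_hasCompactSupport hc)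
      (fun _ _ => differentiableAt_const _) (fun x _ => hg.differentiable one_ne_zero x)
    simpa using this
  simp only [divergence_eq_traceCLM]
  rw [ContinuousLinearMap.integral_comp_comm _ hi, h0, map_zero]

theorem IsTestField.comp_add_right (hg : IsTestField g) (y : EuclideanSpace ℝ (Fin n)) :
    IsTestField (fun x => g (x + y)) :=
  ⟨hg.1.comp (contDiff_id.add contDiff_const),
    hg.2.1.comp_homeomorph (Homeomorph.addRight y), fun x => hg.2.2 (x + y)⟩

end Divergence

section Perimeter

variable {n : ℕ} {A B : Set (EuclideanSpace ℝ (Fin n))}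
  {g : EuclideanSpace ℝ (Fin n) → EuclideanSpace ℝ (Fin n)}

theorem IsTestField.setIntegral_le (hg : IsTestField g) (hA : perimeter A ≠ ⊤) :
    ∫ x in A, divergence g x ≤ (perimeter A).toReal :=
  (ENNReal.ofReal_le_iff_le_toReal hA).1 (le_iSup₂_of_le g hg le_rfl)

theorem IsTestField.setIntegral_translate_le (hg : IsTestField g) (hA : perimeter A ≠ ⊤)
    (y : EuclideanSpace ℝ (Fin n)) :
    ∫ x in A, divergence g (x + y) ≤ (perimeter A).toReal := by
  simpa only [divergence_comp_add_right] using (hg.comp_add_right y).setIntegral_le hA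

theorem integrable_mul_indicator_one_sub (hAm : MeasurableSet A)
    {X : Type*} [MeasurableSpace X] {μ : Measure X} {f : X → ℝ} (hf : Integrable f μ)
    {p : X → EuclideanSpace ℝ (Fin n)} (hp : Measurable p) :
    Integrable (fun t => f t * A.indicator (1 : EuclideanSpace ℝ (Fin n) → ℝ) (p t)) μ := by
  refine hf.mul_bdd (c := 1) ?_ (Eventually.of_forall fun t => ?_)
  · exact ((measurable_one.indicator hAm).comp hp).aestronglyMeasurable
  · by_cases ht : p t ∈ A <;> simp [ht]

/-- Averaging translates of a set does not increase the total variation. -/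
theorem IsTestField.integral_average_le (hg : IsTestField g) (hAm : MeasurableSet A)
    (hA : perimeter A ≠ ⊤) {ρ : EuclideanSpace ℝ (Fin n) → ℝ} (hρi : Integrable ρ)
    (hρ0 : ∀ t, 0 ≤ ρ t) (hρ1 : ∫ t, ρ t = 1) :
    ∫ x, (∫ t, ρ t * A.indicator 1 (x - t)) * divergence g x ≤ (perimeter A).toReal := by
  set χ : EuclideanSpace ℝ (Fin n) → ℝ := A.indicator 1 with hχ
  have hD := integrable_divergence hg.1 hg.2.1
  have hprod : Integrable (fun p : EuclideanSpace ℝ (Fin n) × EuclideanSpace ℝ (Fin n) =>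
      (divergence g p.1 * ρ p.2) * χ (p.1 - p.2)) (volume.prod volume) :=
    integrable_mul_indicator_one_sub hAm (hD.mul_prod hρi) (measurable_fst.sub measurable_snd)
  have hinner : ∀ t, ∫ x, divergence g x * ρ t * χ (x - t)
      ≤ ρ t * (perimeter A).toReal := fun t => by
    have h1 : ∫ x, divergence g x * ρ t * χ (x - t)
        = ρ t * ∫ x in A, divergence g (x + t) := by
      rw [← integral_add_right_eq_self _ t, ← integral_indicator hAm, ← integral_const_mul]
      refine integral_congr_ae (Eventually.of_forall fun x => ?_)
      by_cases hx : x ∈ A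
      · simp [hχ, hx, mul_comm]
      · simp [hχ, hx]
    rw [h1]
    exact mul_le_mul_of_nonneg_left (hg.setIntegral_translate_le hA t) (hρ0 t)
  calc ∫ x, (∫ t, ρ t * χ (x - t)) * divergence g x
      = ∫ x, ∫ t, divergence g x * ρ t * χ (x - t) := by
        refine integral_congr_ae (Eventually.of_forall fun x => ?_)
        simp only [mul_assoc]
        rw [integral_const_mul, mul_comm]
    _ = ∫ t, ∫ x, divergence g x * ρ t * χ (x - t) := integral_integral_swap hprod
    _ ≤ ∫ t, ρ t * (perimeter A).toReal :=
        integral_mono hprod.integral_prod_right (hρi.mul_const _) hinner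
    _ = (perimeter A).toReal := by rw [integral_mul_const, hρ1, one_mul]

/-- Mollification of a measurable set of finite perimeter. -/
theorem exists_smooth_approx (hAm : MeasurableSet A) (hA : perimeter A ≠ ⊤) :
    ∃ u : ℕ → EuclideanSpace ℝ (Fin n) → ℝ,
      (∀ k, ContDiff ℝ 1 (u k)) ∧ (∀ k x, 0 ≤ u k x ∧ u k x ≤ 1) ∧
      (∀ᵐ x, Tendsto (fun k => u k x) atTop (𝓝 (A.indicator 1 x))) ∧
      (∀ k g, IsTestField g → ∫ x, u k x * divergence g x ≤ (perimeter A).toReal) ∧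
      (Bornology.IsBounded A → ∀ k, HasCompactSupport (u k)) := by
  set χ : EuclideanSpace ℝ (Fin n) → ℝ := A.indicator 1 with hχ
  have hχm : Measurable χ := measurable_one.indicator hAm
  have hχ0 : ∀ x, 0 ≤ χ x := fun x => indicator_nonneg (fun _ _ => zero_le_one) x
  have hχ1 : ∀ x, χ x ≤ 1 := fun x => indicator_le' (fun _ _ => le_rfl) (fun _ _ => zero_le_one) x
  have hχn : ∀ x, ‖χ x‖ ≤ 1 := fun x => by rw [Real.norm_of_nonneg (hχ0 x)]; exact hχ1 x
  have hχloc : LocallyIntegrable χ :=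
    (locallyIntegrable_const (1 : ℝ)).mono hχm.aestronglyMeasurable
      (Eventually.of_forall fun x => by simpa using hχn x)
  let φ : ℕ → ContDiffBump (0 : EuclideanSpace ℝ (Fin n)) := fun k =>
    ⟨1 / ((k : ℝ) + 1), 2 * (1 / ((k : ℝ) + 1)), by positivity, by
      have : 0 < 1 / ((k : ℝ) + 1) := by positivity
      linarith⟩
  let ρ : ℕ → EuclideanSpace ℝ (Fin n) → ℝ := fun k => (φ k).normed volume
  have hρi : ∀ k, Integrable (ρ k) := fun k => (φ k).integrable_normed
  have hρ0 : ∀ k t, 0 ≤ ρ k t := fun k t => (φ k).nonneg_normed t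
  have hρ1 : ∀ k, ∫ t, ρ k t = 1 := fun k => (φ k).integral_normed
  have hint : ∀ k x, Integrable fun t => ρ k t * χ (x - t) := fun k x =>
    integrable_mul_indicator_one_sub hAm (hρi k) (measurable_const.sub measurable_id)
  refine ⟨fun k => convolution (ρ k) χ (ContinuousLinearMap.lsmul ℝ ℝ) volume,
    fun k => ?_, fun k x => ⟨?_, ?_⟩, ?_, fun k g hg => ?_, fun hb k => ?_⟩
  · exact (φ k).hasCompactSupport_normed.contDiff_convolution_left _ (φ k).contDiff_normed hχloc
  · exact integral_nonneg fun t => mul_nonneg (hρ0 k t) (hχ0 _)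
  · rw [← hρ1 k]
    exact integral_mono (hint k x) (hρi k) fun t => mul_le_of_le_one_right (hρ0 k t) (hχ1 _)
  · refine ContDiffBump.ae_convolution_tendsto_right_of_locallyIntegrable (φ := φ) (K := 2) ?_
      (Eventually.of_forall fun k => le_rfl) hχloc
    simpa [φ] using tendsto_one_div_add_atTop_nhds_zero_nat.const_mul (2 : ℝ)
  · exact hg.integral_average_le hAm hA (hρi k) (hρ0 k) (hρ1 k)
  · refine HasCompactSupport.convolution _ (φ k).hasCompactSupport_normed ?_
    exact HasCompactSupport.of_support_subset_isCompact hb.isCompact_closure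
      (support_indicator_subset.trans subset_closure)

theorem perimeter_le_ofReal {c : ℝ} (h : ∀ g, IsTestField g → ∫ x in A, divergence g x ≤ c) :
    perimeter A ≤ ENNReal.ofReal c :=
  iSup₂_le fun g hg => ENNReal.ofReal_le_ofReal (h g hg)

theorem isTestField_zero : IsTestField (fun _ : EuclideanSpace ℝ (Fin n) => 0) :=
  ⟨contDiff_const, HasCompactSupport.zero, fun _ => by simp⟩

theorem integral_divergence_zero (μ : Measure (EuclideanSpace ℝ (Fin n))) :
    ∫ x, divergence (fun _ : EuclideanSpace ℝ (Fin n) => 0) x ∂μ = 0 := by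
  simp [divergence_eq_traceCLM]

theorem hasCompactSupport_smul_add_smul
    {h : EuclideanSpace ℝ (Fin n) → EuclideanSpace ℝ (Fin n)} (hg : HasCompactSupport g)
    (hh : HasCompactSupport h) (a b : EuclideanSpace ℝ (Fin n) → ℝ) :
    HasCompactSupport fun x => a x • g x + b x • h x :=
  (HasCompactSupport.smul_left (f := a) hg).add (HasCompactSupport.smul_left (f := b) hh)

theorem divergence_smul_add_smul {a b : EuclideanSpace ℝ (Fin n) → ℝ}
    {h : EuclideanSpace ℝ (Fin n) → EuclideanSpace ℝ (Fin n)} {x : EuclideanSpace ℝ (Fin n)}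
    (ha : DifferentiableAt ℝ a x) (hb : DifferentiableAt ℝ b x)
    (hg : DifferentiableAt ℝ g x) (hh : DifferentiableAt ℝ h x) :
    divergence (fun y => a y • g y + b y • h y) x
      = (a x * divergence g x + fderiv ℝ a x (g x))
        + (b x * divergence h x + fderiv ℝ b x (h x)) := by
  rw [divergence_add (ha.fun_smul hg) (hb.fun_smul hh), divergence_smul ha hg,
    divergence_smul hb hh]

/-- A convex combination of test fields is a test field. -/
theorem IsTestField.convex_comb {h : EuclideanSpace ℝ (Fin n) → EuclideanSpace ℝ (Fin n)}
    (hg : IsTestField g) (hh : IsTestField h) {s : EuclideanSpace ℝ (Fin n) → ℝ}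
    (hs : ContDiff ℝ 1 s) (hs1 : ∀ x, |s x| ≤ 1) :
    IsTestField fun x => ((1 + s x) / 2) • g x + ((1 - s x) / 2) • h x := by
  refine ⟨((((contDiff_const.add hs).div_const 2)).smul hg.1).add
    (((contDiff_const.sub hs).div_const 2).smul hh.1),
    hasCompactSupport_smul_add_smul hg.2.1 hh.2.1 _ _, fun x => ?_⟩
  obtain ⟨h1, h2⟩ := abs_le.1 (hs1 x)
  have ha : 0 ≤ (1 + s x) / 2 := by linarith
  have hb : 0 ≤ (1 - s x) / 2 := by linarith
  calc ‖((1 + s x) / 2) • g x + ((1 - s x) / 2) • h x‖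
      ≤ (1 + s x) / 2 * ‖g x‖ + (1 - s x) / 2 * ‖h x‖ := by
        refine (norm_add_le _ _).trans ?_
        rw [norm_smul, norm_smul, Real.norm_of_nonneg ha, Real.norm_of_nonneg hb]
    _ ≤ (1 + s x) / 2 * 1 + (1 - s x) / 2 * 1 := by
        gcongr
        exacts [hg.2.2 x, hh.2.2 x]
    _ = 1 := by ring

theorem integrable_mul_divergence {w : EuclideanSpace ℝ (Fin n) → ℝ} (hw : Continuous w)
    (hg : IsTestField g) : Integrable fun x => w x * divergence g x :=
  (hw.mul (continuous_divergence hg.1)).integrable_of_hasCompactSupport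
    (hasCompactSupport_divergence hg.2.1).mul_left

/-- Submodularity of the total variation for smoothed maximum and minimum. -/
theorem integral_smooth_max_add_min_le
    {h : EuclideanSpace ℝ (Fin n) → EuclideanSpace ℝ (Fin n)}
    {u v : EuclideanSpace ℝ (Fin n) → ℝ} (hu : ContDiff ℝ 1 u) (hv : ContDiff ℝ 1 v) {P Q δ : ℝ}
    (hP : ∀ G, IsTestField G → ∫ x, u x * divergence G x ≤ P)
    (hQ : ∀ G, IsTestField G → ∫ x, v x * divergence G x ≤ Q)
    (hg : IsTestField g) (hh : IsTestField h) (hδ : 0 < δ) :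
    (∫ x, (u x + v x + √((u x - v x) ^ 2 + δ ^ 2)) / 2 * divergence g x) +
      ∫ x, (u x + v x - √((u x - v x) ^ 2 + δ ^ 2)) / 2 * divergence h x ≤ P + Q := by
  set σ : EuclideanSpace ℝ (Fin n) → ℝ := fun x => √((u x - v x) ^ 2 + δ ^ 2) with hσ
  have hpos : ∀ x, 0 < (u x - v x) ^ 2 + δ ^ 2 := fun x => by positivity
  have hσpos : ∀ x, 0 < σ x := fun x => Real.sqrt_pos.2 (hpos x)
  have hσC : ContDiff ℝ 1 σ := (((hu.sub hv).pow 2).add contDiff_const).sqrt fun x => (hpos x).ne'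
  set s : EuclideanSpace ℝ (Fin n) → ℝ := fun x => (u x - v x) / σ x with hs
  have hsC : ContDiff ℝ 1 s := (hu.sub hv).div hσC fun x => (hσpos x).ne'
  have hs1 : ∀ x, |s x| ≤ 1 := fun x => by
    rw [hs, abs_div, abs_of_pos (hσpos x), div_le_one (hσpos x)]
    exact Real.abs_le_sqrt (by nlinarith [sq_nonneg δ])
  set G := fun x => ((1 + s x) / 2) • g x + ((1 - s x) / 2) • h x with hGdef
  set H := fun x => ((1 + s x) / 2) • h x + ((1 - s x) / 2) • g x with hHdef
  have hG : IsTestField G := hg.convex_comb hh hsC hs1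
  have hH : IsTestField H := hh.convex_comb hg hsC hs1
  set m : EuclideanSpace ℝ (Fin n) → ℝ := fun x => (u x + v x + σ x) / 2 with hm
  set l : EuclideanSpace ℝ (Fin n) → ℝ := fun x => (u x + v x - σ x) / 2 with hl
  have hmC : ContDiff ℝ 1 m := ((hu.add hv).add hσC).div_const 2
  have hlC : ContDiff ℝ 1 l := ((hu.add hv).sub hσC).div_const 2
  have hdu := hu.differentiable one_ne_zero
  have hdv := hv.differentiable one_ne_zero
  have hσ' : ∀ x, HasFDerivAt σ (s x • (fderiv ℝ u x - fderiv ℝ v x)) x := fun x => by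
    have h1 := ((((hdu x).hasFDerivAt.sub (hdv x).hasFDerivAt).pow 2).add_const (δ ^ 2)).sqrt
      (hpos x).ne'
    refine h1.congr_fderiv ?_
    ext w
    have := (hσpos x).ne'
    simp [hs, hσ] at this ⊢
    field_simp
  have hm' : ∀ x w, fderiv ℝ m x w
      = (1 + s x) / 2 * fderiv ℝ u x w + (1 - s x) / 2 * fderiv ℝ v x w := fun x w => by
    have h1 := (((hdu x).hasFDerivAt.add (hdv x).hasFDerivAt).add (hσ' x)).mul_const (2 : ℝ)⁻¹
    have h2 : HasFDerivAt m _ x := h1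
    rw [h2.fderiv]
    simp
    ring
  have hl' : ∀ x w, fderiv ℝ l x w
      = (1 - s x) / 2 * fderiv ℝ u x w + (1 + s x) / 2 * fderiv ℝ v x w := fun x w => by
    have h1 := (((hdu x).hasFDerivAt.add (hdv x).hasFDerivAt).sub (hσ' x)).mul_const (2 : ℝ)⁻¹
    have h2 : HasFDerivAt l _ x := h1
    rw [h2.fderiv]
    simp
    ring
  have hzero : ∫ x, divergence
      (fun x => (m x • g x + l x • h x) - (u x • G x + v x • H x)) x = 0 := by
    refine integral_divergence_eq_zero
      (((hmC.smul hg.1).add (hlC.smul hh.1)).sub ((hu.smul hG.1).add (hv.smul hH.1))) ?_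
    exact (hasCompactSupport_smul_add_smul hg.2.1 hh.2.1 m l).sub
      (hasCompactSupport_smul_add_smul hG.2.1 hH.2.1 u v)
  have hdiv : ∀ x, divergence (fun x => (m x • g x + l x • h x) - (u x • G x + v x • H x)) x
      = (m x * divergence g x + l x * divergence h x)
        - (u x * divergence G x + v x * divergence H x) := fun x => by
    have dm := hmC.differentiable one_ne_zero x
    have dl := hlC.differentiable one_ne_zero x
    have dg := hg.1.differentiable one_ne_zero x
    have dh := hh.1.differentiable one_ne_zero x
    have dG := hG.1.differentiable one_ne_zero x
    have dH := hH.1.differentiable one_ne_zero x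
    rw [divergence_sub ((dm.fun_smul dg).fun_add (dl.fun_smul dh))
        (((hdu x).fun_smul dG).fun_add ((hdv x).fun_smul dH)),
      divergence_smul_add_smul dm dl dg dh, divergence_smul_add_smul (hdu x) (hdv x) dG dH,
      hm', hl']
    simp only [hGdef, hHdef, map_add, map_smul, smul_eq_mul]
    ring
  simp only [hdiv] at hzero
  have i1 := integrable_mul_divergence hmC.continuous hg
  have i2 := integrable_mul_divergence hlC.continuous hh
  have i3 := integrable_mul_divergence hu.continuous hG
  have i4 := integrable_mul_divergence hv.continuous hH
  rw [integral_sub (i1.fun_add i2) (i3.fun_add i4), integral_add i1 i2, integral_add i3 i4] at hzero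
  linarith [hP G hG, hQ H hH]

theorem setIntegral_union_add_inter_le {h : EuclideanSpace ℝ (Fin n) → EuclideanSpace ℝ (Fin n)}
    (hAm : MeasurableSet A) (hBm : MeasurableSet B)
    (hA : perimeter A ≠ ⊤) (hB : perimeter B ≠ ⊤) (hg : IsTestField g) (hh : IsTestField h) :
    (∫ x in A ∪ B, divergence g x) + ∫ x in A ∩ B, divergence h x
      ≤ (perimeter A).toReal + (perimeter B).toReal := by
  obtain ⟨u, huC, hub, hul, huP, -⟩ := exists_smooth_approx hAm hA
  obtain ⟨v, hvC, hvb, hvl, hvP, -⟩ := exists_smooth_approx hBm hB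
  set δ : ℕ → ℝ := fun k => 1 / ((k : ℝ) + 1) with hδ
  have hδpos : ∀ k, 0 < δ k := fun k => by positivity
  have hδ1 : ∀ k, δ k ≤ 1 := fun k => by
    rw [hδ, div_le_one (by positivity)]
    linarith [(Nat.cast_nonneg k : (0 : ℝ) ≤ k)]
  have hδ0 : Tendsto δ atTop (𝓝 0) := tendsto_one_div_add_atTop_nhds_zero_nat
  set σ : ℕ → EuclideanSpace ℝ (Fin n) → ℝ := fun k x =>
    √((u k x - v k x) ^ 2 + δ k ^ 2) with hσ
  have hσc : ∀ k, Continuous (σ k) := fun k =>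
    ((((huC k).continuous.sub (hvC k).continuous).pow 2).add continuous_const).sqrt
  have hσb : ∀ k x, 0 ≤ σ k x ∧ σ k x ≤ 2 := fun k x => by
    refine ⟨Real.sqrt_nonneg _, Real.sqrt_le_iff.2 ⟨by norm_num, ?_⟩⟩
    nlinarith [hub k x, hvb k x, hδpos k, hδ1 k]
  have hσl : ∀ᵐ x, Tendsto (fun k => σ k x) atTop
      (𝓝 |A.indicator (1 : EuclideanSpace ℝ (Fin n) → ℝ) x
        - B.indicator (1 : EuclideanSpace ℝ (Fin n) → ℝ) x|) := by
    filter_upwards [hul, hvl] with x hx hy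
    have := (((hx.sub hy).pow 2).add (hδ0.pow 2)).sqrt
    simpa [Real.sqrt_sq_eq_abs] using this
  have key : ∀ (w : ℕ → EuclideanSpace ℝ (Fin n) → ℝ) (C : Set (EuclideanSpace ℝ (Fin n)))
      (f : EuclideanSpace ℝ (Fin n) → EuclideanSpace ℝ (Fin n)), IsTestField f →
      MeasurableSet C → (∀ k, Continuous (w k)) → (∀ k x, |w k x| ≤ 2) →
      (∀ᵐ x, Tendsto (fun k => w k x) atTop (𝓝 (C.indicator 1 x))) →
      Tendsto (fun k => ∫ x, w k x * divergence f x) atTop (𝓝 (∫ x in C, divergence f x)) := by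
    intro w C f hf hC hwc hwb hwl
    rw [← integral_indicator hC]
    refine tendsto_integral_of_dominated_convergence (fun x => 2 * ‖divergence f x‖)
      (fun k => (integrable_mul_divergence (hwc k) hf).aestronglyMeasurable)
      ((integrable_divergence hf.1 hf.2.1).norm.const_mul 2)
      (fun k => Eventually.of_forall fun x => ?_) ?_
    · rw [norm_mul]
      exact mul_le_mul_of_nonneg_right (hwb k x) (norm_nonneg _)
    · filter_upwards [hwl] with x hx
      have := hx.mul_const (divergence f x)
      by_cases hxC : x ∈ C <;> simpa [hxC] using this
  have t1 := key (fun k x => (u k x + v k x + σ k x) / 2) (A ∪ B) g hg (hAm.union hBm)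
    (fun k => (((huC k).continuous.add (hvC k).continuous).add (hσc k)).div_const 2)
    (fun k x => abs_le.2 ⟨by linarith [hub k x, hvb k x, hσb k x],
      by linarith [hub k x, hvb k x, hσb k x]⟩) (by
      filter_upwards [hul, hvl, hσl] with x hx hy hz
      have := ((hx.add hy).add hz).div_const 2
      convert this using 2
      by_cases hxA : x ∈ A <;> by_cases hxB : x ∈ B <;> simp [hxA, hxB])
  have t2 := key (fun k x => (u k x + v k x - σ k x) / 2) (A ∩ B) h hh (hAm.inter hBm)
    (fun k => (((huC k).continuous.add (hvC k).continuous).sub (hσc k)).div_const 2)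
    (fun k x => abs_le.2 ⟨by linarith [hub k x, hvb k x, hσb k x],
      by linarith [hub k x, hvb k x, hσb k x]⟩) (by
      filter_upwards [hul, hvl, hσl] with x hx hy hz
      have := ((hx.add hy).sub hz).div_const 2
      convert this using 2
      by_cases hxA : x ∈ A <;> by_cases hxB : x ∈ B <;> simp [hxA, hxB])
  exact le_of_tendsto' (t1.add t2) fun k =>
    integral_smooth_max_add_min_le (huC k) (hvC k) (huP k) (hvP k) hg hh (hδpos k)

/-- Submodularity of the perimeter. -/
theorem perimeter_union_add_perimeter_inter_le (hAm : MeasurableSet A) (hBm : MeasurableSet B) :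
    perimeter (A ∪ B) + perimeter (A ∩ B) ≤ perimeter A + perimeter B := by
  by_cases hA : perimeter A = ⊤
  · simp [hA]
  by_cases hB : perimeter B = ⊤
  · simp [hB]
  set c := (perimeter A).toReal + (perimeter B).toReal with hc
  have hle := fun g h (hg : IsTestField g) (hh : IsTestField h) =>
    setIntegral_union_add_inter_le hAm hBm hA hB hg hh
  have hc0 : 0 ≤ c := by positivity
  have hI : perimeter (A ∩ B) ≤ ENNReal.ofReal c := perimeter_le_ofReal fun h hh => by
    simpa [integral_divergence_zero] using hle _ h isTestField_zero hh
  have hIt : perimeter (A ∩ B) ≠ ⊤ := ne_top_of_le_ne_top ENNReal.ofReal_ne_top hI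
  have hU : perimeter (A ∪ B) ≤ ENNReal.ofReal (c - (perimeter (A ∩ B)).toReal) := by
    refine perimeter_le_ofReal fun g hg => ?_
    have h1 : perimeter (A ∩ B) ≤ ENNReal.ofReal (c - ∫ x in A ∪ B, divergence g x) :=
      perimeter_le_ofReal fun h hh => by linarith [hle g h hg hh]
    have h2 : 0 ≤ c - ∫ x in A ∪ B, divergence g x := by
      have := hle g _ hg isTestField_zero
      rw [integral_divergence_zero] at this
      linarith
    have h3 := ENNReal.toReal_le_of_le_ofReal h2 h1
    linarith
  calc perimeter (A ∪ B) + perimeter (A ∩ B)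
      ≤ ENNReal.ofReal (c - (perimeter (A ∩ B)).toReal)
        + ENNReal.ofReal (perimeter (A ∩ B)).toReal := by
        rw [ENNReal.ofReal_toReal hIt]
        gcongr
    _ = ENNReal.ofReal c := by
        rw [← ENNReal.ofReal_add _ ENNReal.toReal_nonneg]
        · ring_nf
        · linarith [ENNReal.toReal_le_of_le_ofReal hc0 hI]
    _ = perimeter A + perimeter B := by
        rw [hc, ENNReal.ofReal_add ENNReal.toReal_nonneg ENNReal.toReal_nonneg,
          ENNReal.ofReal_toReal hA, ENNReal.ofReal_toReal hB]

theorem exists_isTestField_lt (A : Set (EuclideanSpace ℝ (Fin n))) {ε : ℝ} (hε : 0 < ε) :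
    ∃ g, IsTestField g ∧ (perimeter A).toReal - ε < ∫ x in A, divergence g x := by
  by_contra! hcon
  have h0 := hcon _ isTestField_zero
  rw [integral_divergence_zero] at h0
  have := ENNReal.toReal_le_of_le_ofReal h0 (perimeter_le_ofReal hcon)
  linarith

/-- Lower semicontinuity of the perimeter with respect to `L¹` convergence. -/
theorem exists_perimeter_le_add (hAm : MeasurableSet A) {ε : ℝ}
    (hε : 0 < ε) :
    ∃ δ : ℝ, 0 < δ ∧ ∀ E, MeasurableSet E → perimeter E ≠ ⊤ →
      volume (symmDiff E A) < ENNReal.ofReal δ →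
      (perimeter A).toReal ≤ (perimeter E).toReal + ε := by
  obtain ⟨g, hg, hlt⟩ := exists_isTestField_lt A (half_pos hε)
  obtain ⟨M, hM⟩ := (continuous_divergence hg.1).bounded_above_of_compact_support
    (hasCompactSupport_divergence hg.2.1)
  have hM0 : 0 ≤ M := (norm_nonneg _).trans (hM 0)
  refine ⟨ε / (4 * (M + 1)), by positivity, fun E hEm hE hlt' => ?_⟩
  have hi := integrable_divergence hg.1 hg.2.1
  have hreal : ∀ s ⊆ symmDiff E A, |∫ x in s, divergence g x| ≤ ε / 4 := fun s hs => by
    have hs' := (measure_mono hs).trans_lt hlt'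
    have h1 := norm_setIntegral_le_of_norm_le_const (hs'.trans ENNReal.ofReal_lt_top)
      fun x _ => hM x
    have h2 : volume.real s ≤ ε / (4 * (M + 1)) :=
      ENNReal.toReal_le_of_le_ofReal (by positivity) hs'.le
    calc |∫ x in s, divergence g x| ≤ M * volume.real s := h1
      _ ≤ (M + 1) * (ε / (4 * (M + 1))) := by gcongr; linarith
      _ = ε / 4 := by field_simp
  have h1 := integral_inter_add_sdiff (f := divergence g) hEm (s := A) hi.integrableOn
  have h2 := integral_inter_add_sdiff (f := divergence g) hAm (s := E) hi.integrableOn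
  rw [inter_comm] at h2
  have h3 := (abs_le.1 (hreal (A \ E) subset_union_right)).2
  have h4 := (abs_le.1 (hreal (E \ A) subset_union_left)).1
  linarith [hg.setIntegral_le hE]

theorem setIntegral_sub_translate_le (hAb : Bornology.IsBounded A)
    (hA : perimeter A ≠ ⊤) {φ : EuclideanSpace ℝ (Fin n) → ℝ} (hφ : ContDiff ℝ 1 φ)
    (hφc : HasCompactSupport φ) (hφ1 : ∀ x, |φ x| ≤ 1) (y : EuclideanSpace ℝ (Fin n)) :
    ∫ x in A, (φ x - φ (x + y)) ≤ ‖y‖ * (perimeter A).toReal := by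
  rcases eq_or_ne y 0 with rfl | hy
  · simp
  have hy' : 0 < ‖y‖ := norm_pos_iff.2 hy
  set g : EuclideanSpace ℝ (Fin n) → EuclideanSpace ℝ (Fin n) := fun x => φ x • (-‖y‖⁻¹ • y)
  have hg : IsTestField g := by
    refine ⟨hφ.smul contDiff_const, hφc.mono fun x hx h0 => hx ?_, fun x => ?_⟩
    · simp [g, h0]
    rw [norm_smul, norm_smul, norm_neg, norm_inv, norm_norm, inv_mul_cancel₀ hy'.ne', mul_one]
    exact hφ1 x
  have hdiv : ∀ x, fderiv ℝ φ x y = -(‖y‖ * divergence g x) := fun x => by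
    rw [divergence_smul (hφ.differentiable one_ne_zero x) (differentiableAt_const _)]
    have : divergence (fun _ : EuclideanSpace ℝ (Fin n) => -‖y‖⁻¹ • y) x = 0 := by
      simp [divergence_eq_traceCLM]
    rw [this, map_smul, smul_eq_mul]
    field_simp
    ring
  have hc : Continuous fun p : ℝ × EuclideanSpace ℝ (Fin n) => divergence g (p.2 + p.1 • y) :=
    (continuous_divergence hg.1).comp
      (continuous_snd.add (continuous_fst.smul continuous_const))
  have hftc : ∀ x, φ x - φ (x + y) = ‖y‖ * ∫ t in (0 : ℝ)..1, divergence g (x + t • y) := by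
    intro x
    have hct : Continuous fun t : ℝ => divergence g (x + t • y) :=
      hc.comp (continuous_id.prodMk continuous_const)
    have h1 := intervalIntegral.integral_eq_sub_of_hasDerivAt (a := 0) (b := 1)
      (f := fun t : ℝ => φ (x + t • y)) (f' := fun t => -(‖y‖ * divergence g (x + t • y)))
      (fun t _ => by
        have h2 : HasDerivAt (fun t : ℝ => x + t • y) y t := by
          simpa using ((hasDerivAt_id t).smul_const y).const_add x
        have h3 := (hφ.differentiable one_ne_zero (x + t • y)).hasFDerivAt.comp_hasDerivAt t h2
        rw [hdiv] at h3
        exact h3) (Continuous.intervalIntegrable (by fun_prop) 0 1)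
    rw [intervalIntegral.integral_neg, intervalIntegral.integral_const_mul] at h1
    simp only [one_smul, zero_smul, add_zero] at h1
    linarith
  obtain ⟨M, hM⟩ := (continuous_divergence hg.1).bounded_above_of_compact_support
    (hasCompactSupport_divergence hg.2.1)
  have : IsFiniteMeasure (volume.restrict A) := ⟨by simpa using hAb.measure_lt_top⟩
  have : IsFiniteMeasure ((volume : Measure ℝ).restrict (uIoc 0 1)) := ⟨by simp [uIoc]⟩
  have hint : Integrable (Function.uncurry fun (t : ℝ) x => divergence g (x + t • y))
      ((volume.restrict (uIoc 0 1)).prod (volume.restrict A)) :=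
    Integrable.of_bound hc.aestronglyMeasurable M (Eventually.of_forall fun p => hM _)
  simp only [hftc]
  rw [integral_const_mul, ← intervalIntegral_integral_swap hint]
  refine mul_le_mul_of_nonneg_left ?_ hy'.le
  calc ∫ t in (0 : ℝ)..1, ∫ x in A, divergence g (x + t • y)
      ≤ ∫ t in (0 : ℝ)..1, (perimeter A).toReal := by
        refine intervalIntegral.integral_mono_on zero_le_one ?_ intervalIntegrable_const
          fun t _ => hg.setIntegral_translate_le hA _
        rw [intervalIntegrable_iff]
        exact hint.integral_prod_left
    _ = (perimeter A).toReal := by simp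

theorem volume_le_inter_translate_add (hAm : MeasurableSet A) (hAb : Bornology.IsBounded A)
    (hA : perimeter A ≠ ⊤) (y : EuclideanSpace ℝ (Fin n)) :
    volume.real A ≤ volume.real (A ∩ (fun x => x + y) ⁻¹' A) + ‖y‖ * (perimeter A).toReal := by
  obtain ⟨u, huC, hub, hul, -, huc⟩ := exists_smooth_approx hAm hA
  have hAfin : volume A ≠ ⊤ := hAb.measure_lt_top.ne
  have hm : Measurable fun x : EuclideanSpace ℝ (Fin n) => x + y := measurable_add_const y
  have hul' : ∀ᵐ x, Tendsto (fun k => u k (x + y)) atTop (𝓝 (A.indicator 1 (x + y))) :=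
    (measurePreserving_add_right volume y).quasiMeasurePreserving.ae hul
  have hlim : Tendsto (fun k => ∫ x in A, (u k x - u k (x + y))) atTop
      (𝓝 (∫ x in A, (A.indicator 1 x - A.indicator 1 (x + y)))) := by
    refine tendsto_integral_of_dominated_convergence (fun _ => 1) (fun k => ?_)
      (integrableOn_const hAfin) (fun k => Eventually.of_forall fun x => ?_) ?_
    · exact ((huC k).continuous.sub
        ((huC k).continuous.comp (continuous_id.add continuous_const))).aestronglyMeasurable
    · exact abs_le.2 ⟨by linarith [hub k x, hub k (x + y)], by linarith [hub k x, hub k (x + y)]⟩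
    · exact ae_restrict_of_ae (by filter_upwards [hul, hul'] with x hx hx' using hx.sub hx')
  have hle := le_of_tendsto' hlim fun k => setIntegral_sub_translate_le hAb hA (huC k)
    (huc hAb k) (fun x => abs_le.2 ⟨by linarith [hub k x], (hub k x).2⟩) y
  have hval : ∫ x in A, (A.indicator (1 : EuclideanSpace ℝ (Fin n) → ℝ) x
        - A.indicator (1 : EuclideanSpace ℝ (Fin n) → ℝ) (x + y))
      = volume.real A - volume.real (A ∩ (fun x => x + y) ⁻¹' A) := by
    have h1 : ∀ x, A.indicator (1 : EuclideanSpace ℝ (Fin n) → ℝ) (x + y)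
      = ((fun x => x + y) ⁻¹' A).indicator 1 x := fun x => rfl
    have hi : ∀ s : Set (EuclideanSpace ℝ (Fin n)), MeasurableSet s →
        Integrable (s.indicator (1 : EuclideanSpace ℝ (Fin n) → ℝ)) (volume.restrict A) :=
      fun s hs => (integrableOn_const hAfin (C := (1 : ℝ))).indicator hs
    simp only [h1]
    rw [integral_sub (hi _ hAm) (hi _ (hm hAm)), integral_indicator_one hAm,
      integral_indicator_one (hm hAm), measureReal_restrict_apply hAm,
      measureReal_restrict_apply (hm hAm), inter_self, inter_comm]
  linarith

theorem lintegral_volume_inter_translate (hAm : MeasurableSet A) :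
    ∫⁻ y, volume (A ∩ (fun x => x + y) ⁻¹' A) = volume A * volume A := by
  have hm : ∀ y, MeasurableSet ((fun x => x + y) ⁻¹' A) := fun y => measurable_add_const y hAm
  have hχ : Measurable (A.indicator (1 : EuclideanSpace ℝ (Fin n) → ℝ≥0∞)) :=
    measurable_one.indicator hAm
  calc ∫⁻ y, volume (A ∩ (fun x => x + y) ⁻¹' A)
      = ∫⁻ y, ∫⁻ x, A.indicator 1 x * A.indicator 1 (x + y) := by
        refine lintegral_congr fun y => ?_
        rw [← lintegral_indicator_one (hAm.inter (hm y))]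
        refine lintegral_congr fun x => ?_
        by_cases hx : x ∈ A <;> by_cases hy : x + y ∈ A <;> simp [hx, hy]
    _ = ∫⁻ x, ∫⁻ y, A.indicator 1 x * A.indicator 1 (x + y) :=
        lintegral_lintegral_swap ((hχ.comp measurable_snd).mul
          (hχ.comp (measurable_snd.add measurable_fst))).aemeasurable
    _ = ∫⁻ x, A.indicator 1 x * volume A := by
        refine lintegral_congr fun x => ?_
        rw [lintegral_const_mul (A.indicator 1 x) (f := fun y => A.indicator 1 (x + y))
            (hχ.comp (measurable_const_add x)),
          lintegral_add_left_eq_self (A.indicator 1) x, lintegral_indicator_one hAm]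
    _ = volume A * volume A := by
        rw [lintegral_mul_const _ hχ, lintegral_indicator_one hAm]

/-- A weak isoperimetric inequality. -/
theorem volume_mul_volume_ball_le (hAm : MeasurableSet A) (hAb : Bornology.IsBounded A)
    (hA : perimeter A ≠ ⊤) {r : ℝ} (hr : 0 < r) :
    volume.real A * volume.real (ball (0 : EuclideanSpace ℝ (Fin n)) r) ≤
      volume.real A * volume.real A +
        r * (perimeter A).toReal * volume.real (ball (0 : EuclideanSpace ℝ (Fin n)) r) := by
  have hAfin : volume A ≠ ⊤ := hAb.measure_lt_top.ne
  set b := ball (0 : EuclideanSpace ℝ (Fin n)) r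
  have hbfin : volume b ≠ ⊤ := measure_ball_lt_top.ne
  have hc0 : 0 ≤ r * (perimeter A).toReal := by positivity
  have hpt : ∀ y ∈ b, volume A
      ≤ volume (A ∩ (fun x => x + y) ⁻¹' A) + ENNReal.ofReal (r * (perimeter A).toReal) := by
    intro y hy
    have hIfin : volume (A ∩ (fun x => x + y) ⁻¹' A) ≠ ⊤ := measure_ne_top_of_subset
      inter_subset_left hAfin
    rw [← ENNReal.ofReal_toReal hIfin, ← ENNReal.ofReal_add ENNReal.toReal_nonneg hc0,
      ENNReal.le_ofReal_iff_toReal_le hAfin (by positivity)]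
    refine (volume_le_inter_translate_add hAm hAb hA y).trans (add_le_add le_rfl ?_)
    exact mul_le_mul_of_nonneg_right (mem_ball_zero_iff.1 hy).le ENNReal.toReal_nonneg
  have hmain : volume A * volume b
      ≤ volume A * volume A + ENNReal.ofReal (r * (perimeter A).toReal) * volume b := by
    calc volume A * volume b = ∫⁻ _ in b, volume A := by simp
      _ ≤ ∫⁻ y in b, (volume (A ∩ (fun x => x + y) ⁻¹' A)
            + ENNReal.ofReal (r * (perimeter A).toReal)) :=
          setLIntegral_mono' measurableSet_ball hpt
      _ = (∫⁻ y in b, volume (A ∩ (fun x => x + y) ⁻¹' A))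
            + ENNReal.ofReal (r * (perimeter A).toReal) * volume b := by
          rw [lintegral_add_right _ measurable_const]
          simp
      _ ≤ _ := by
          rw [← lintegral_volume_inter_translate hAm]
          gcongr
          exact Measure.restrict_le_self
  have := ENNReal.toReal_mono (by finiteness) hmain
  rw [ENNReal.toReal_add (by finiteness) (by finiteness)] at this
  simpa [Measure.real, ENNReal.toReal_mul, ENNReal.toReal_ofReal hc0] using this

/-- Bounded sets of controlled perimeter-to-volume ratio have volume bounded below. -/
theorem exists_le_volume_of_perimeter_le (n : ℕ) {a : ℝ} (ha : 0 < a) :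
    ∃ c : ℝ, 0 < c ∧ ∀ A : Set (EuclideanSpace ℝ (Fin n)), MeasurableSet A →
      Bornology.IsBounded A → perimeter A ≠ ⊤ → 0 < volume.real A →
      (perimeter A).toReal ≤ a * volume.real A → c ≤ volume.real A := by
  set b := volume.real (ball (0 : EuclideanSpace ℝ (Fin n)) (1 / (2 * a))) with hb
  have hr : 0 < 1 / (2 * a) := by positivity
  have hb0 : 0 < b := ENNReal.toReal_pos (measure_ball_pos _ _ hr).ne' measure_ball_lt_top.ne
  refine ⟨b / 2, by positivity, fun A hAm hAb hA hpos hle => ?_⟩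
  have h1 := volume_mul_volume_ball_le hAm hAb hA hr
  rw [← hb] at h1
  have h2 : 1 / (2 * a) * (perimeter A).toReal * b ≤ volume.real A * (b / 2) := by
    calc 1 / (2 * a) * (perimeter A).toReal * b
        ≤ 1 / (2 * a) * (a * volume.real A) * b := by gcongr
      _ = volume.real A * (b / 2) := by field_simp
  have h3 : volume.real A * (b / 2) ≤ volume.real A * volume.real A := by linarith
  exact le_of_mul_le_mul_left h3 hpos

/-- Intersecting with a set whose union with `F` is close to `Ω` barely increases the
perimeter. -/
theorem exists_perimeter_inter_le_add {Ω : Set (EuclideanSpace ℝ (Fin n))}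
    (hΩm : MeasurableSet Ω) {ε : ℝ} (hε : 0 < ε) :
    ∃ δ : ℝ, 0 < δ ∧ ∀ F U, MeasurableSet F → MeasurableSet U → perimeter F ≠ ⊤ →
      perimeter U ≠ ⊤ → (perimeter U).toReal ≤ (perimeter Ω).toReal + ε / 2 →
      volume (symmDiff (F ∪ U) Ω) < ENNReal.ofReal δ →
      perimeter (F ∩ U) ≠ ⊤ ∧ (perimeter (F ∩ U)).toReal ≤ (perimeter F).toReal + ε := by
  obtain ⟨δ, hδ, H⟩ := exists_perimeter_le_add hΩm (half_pos hε)
  refine ⟨δ, hδ, fun F U hFm hUm hF hU hle hvol => ?_⟩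
  have hsub := perimeter_union_add_perimeter_inter_le hFm hUm
  have hsum : perimeter F + perimeter U ≠ ⊤ := ENNReal.add_ne_top.2 ⟨hF, hU⟩
  obtain ⟨h1, h2⟩ := ENNReal.add_ne_top.1 (ne_top_of_le_ne_top hsum hsub)
  have h3 := ENNReal.toReal_mono hsum hsub
  rw [ENNReal.toReal_add h1 h2, ENNReal.toReal_add hF hU] at h3
  exact ⟨h2, by linarith [H (F ∪ U) (hFm.union hUm) h1 hvol]⟩

theorem volume_real_le_inter_add {F U S : Set (EuclideanSpace ℝ (Fin n))}
    {ε : ℝ} (hε : 0 ≤ ε) (hsub : F \ U ⊆ S) (hS : volume S ≤ ENNReal.ofReal ε) :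
    volume.real F ≤ volume.real (F ∩ U) + ε := by
  have h1 : volume.real F ≤ volume.real (F ∩ U) + volume.real (F \ U) := by
    have := measureReal_union_le (μ := volume) (F ∩ U) (F \ U)
    rwa [inter_union_sdiff] at this
  have h2 : volume.real (F \ U) ≤ ε :=
    ENNReal.toReal_le_of_le_ofReal hε ((measure_mono hsub).trans hS)
  linarith

/-- A set of small perimeter-to-volume ratio bounds the Cheeger constant. -/
theorem cheegerConstant_le_ofReal {Ω F : Set (EuclideanSpace ℝ (Fin n))} (hFm : MeasurableSet F)
    (hsub : F ⊆ Ω) (hF : perimeter F ≠ ⊤) (hv : volume F ≠ ⊤) (hpos : 0 < volume.real F) {a : ℝ}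
    (hle : (perimeter F).toReal ≤ a * volume.real F) :
    cheegerConstant Ω ≤ ENNReal.ofReal a := by
  have hv0 : 0 < volume F := (ENNReal.toReal_pos_iff.1 hpos).1
  refine (iInf₂_le F ⟨hFm, hsub, hv0⟩).trans ?_
  rw [ENNReal.div_le_iff hv0.ne' hv, ← ENNReal.ofReal_toReal hF, ← ENNReal.ofReal_toReal hv,
    ← ENNReal.ofReal_mul' ENNReal.toReal_nonneg]
  exact ENNReal.ofReal_le_ofReal hle

/-- A strict upper bound for the Cheeger constant is witnessed by a competitor. -/
theorem exists_of_cheegerConstant_lt {Ω : Set (EuclideanSpace ℝ (Fin n))}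
    (hΩ : Bornology.IsBounded Ω) {a : ℝ} (h : cheegerConstant Ω < ENNReal.ofReal a) :
    ∃ F ⊆ Ω, MeasurableSet F ∧ perimeter F ≠ ⊤ ∧ volume F ≠ ⊤ ∧ 0 < volume.real F ∧
      (perimeter F).toReal < a * volume.real F := by
  simp only [cheegerConstant, iInf_lt_iff] at h
  obtain ⟨F, ⟨hFm, hsub, hpos⟩, hlt⟩ := h
  have hv : volume F ≠ ⊤ := (hΩ.subset hsub).measure_lt_top.ne
  rw [ENNReal.div_lt_iff (Or.inl hpos.ne') (Or.inl hv)] at hlt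
  have ha : 0 ≤ a := by
    by_contra! hneg
    simp [ENNReal.ofReal_of_nonpos hneg.le] at hlt
  have h1 := ENNReal.toReal_strict_mono (by finiteness) hlt
  rw [ENNReal.toReal_mul, ENNReal.toReal_ofReal ha] at h1
  exact ⟨F, hsub, hFm, hlt.ne_top, hv, ENNReal.toReal_pos hpos.ne' hv, h1⟩

end Perimeter

/-- **Continuity of the Cheeger constant.** Let `Ω` and `Ω_j` (`j ∈ ℕ`) be nonempty bounded
open subsets of `ℝⁿ` (`n ≥ 2`) of finite perimeter.  If `χ_{Ω_j} → χ_Ω` in `L¹(ℝⁿ)`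
(equivalently, the volume of the symmetric differences tends to `0`) and `P(Ω_j) → P(Ω)`,
then `h(Ω_j) → h(Ω)` as `j → ∞`. -/
theorem cheegerConstant_tendsto {n : ℕ} (hn : 2 ≤ n)
    (Ω : Set (EuclideanSpace ℝ (Fin n))) (Ωs : ℕ → Set (EuclideanSpace ℝ (Fin n)))
    (hΩne : Ω.Nonempty) (hΩop : IsOpen Ω) (hΩbd : Bornology.IsBounded Ω)
    (hΩper : perimeter Ω ≠ ⊤)
    (hne : ∀ j, (Ωs j).Nonempty) (hop : ∀ j, IsOpen (Ωs j))
    (hbd : ∀ j, Bornology.IsBounded (Ωs j)) (hper : ∀ j, perimeter (Ωs j) ≠ ⊤)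
    (hL1 : Tendsto (fun j => volume (symmDiff (Ωs j) Ω)) atTop (𝓝 0))
    (hP : Tendsto (fun j => perimeter (Ωs j)) atTop (𝓝 (perimeter Ω))) :
    Tendsto (fun j => cheegerConstant (Ωs j)) atTop (𝓝 (cheegerConstant Ω)) := by
  have hΩm := hΩop.measurableSet
  have hm := fun j => (hop j).measurableSet
  have hvΩ : volume Ω ≠ ⊤ := hΩbd.measure_lt_top.ne
  have hposΩ : 0 < volume.real Ω := ENNReal.toReal_pos (hΩop.measure_pos _ hΩne).ne' hvΩ
  have hsmall : ∀ δ : ℝ, 0 < δ → ∀ᶠ j in atTop, volume (symmDiff (Ωs j) Ω) < ENNReal.ofReal δ :=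
    fun δ hδ => hL1.eventually_lt_const (ENNReal.ofReal_pos.2 hδ)
  have hPreal : ∀ ε : ℝ, 0 < ε →
      ∀ᶠ j in atTop, (perimeter (Ωs j)).toReal ≤ (perimeter Ω).toReal + ε := fun ε hε =>
    (((ENNReal.tendsto_toReal hΩper).comp hP).eventually_lt_const
      (lt_add_of_pos_right _ hε)).mono fun _ h => h.le
  refine tendsto_order.2 ⟨fun a ha => ?_, fun a ha => ?_⟩
  · have hfin : cheegerConstant Ω ≠ ⊤ := by
      refine ne_top_of_le_ne_top ENNReal.ofReal_ne_top
        (cheegerConstant_le_ofReal hΩm Subset.rfl hΩper hvΩ hposΩ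
          (a := (perimeter Ω).toReal / volume.real Ω) ?_)
      rw [div_mul_cancel₀ _ hposΩ.ne']
    obtain ⟨b, hab, hbh⟩ := exists_between ha
    obtain ⟨b', hbb', hbh'⟩ := exists_between hbh
    have hb'fin : b' ≠ ⊤ := hbh'.ne_top
    set β := b'.toReal with hβ
    set η := (cheegerConstant Ω).toReal with hη
    have hβ0 : 0 < β := ENNReal.toReal_pos (pos_of_gt hbb').ne' hb'fin
    have hβη : β < η := ENNReal.toReal_strict_mono hfin hbh'
    have hη0 : 0 < η := hβ0.trans hβη
    obtain ⟨c, hc, hiso⟩ := exists_le_volume_of_perimeter_le n hβ0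
    set ε := (η - β) * c / (2 * (1 + η)) with hεdef
    have hε : 0 < ε := by
      have := sub_pos.2 hβη
      positivity
    obtain ⟨δ, hδ, H⟩ := exists_perimeter_inter_le_add hΩm hε
    filter_upwards [hsmall δ hδ, hsmall ε hε] with j hj1 hj2
    by_contra! hcon
    obtain ⟨F, hFsub, hFm, hF, hFv, hFpos, hFlt⟩ := exists_of_cheegerConstant_lt (hbd j) (a := β)
      (by rw [ENNReal.ofReal_toReal hb'fin]; exact hcon.trans_lt (hab.trans hbb'))
    have hcF := hiso F hFm ((hbd j).subset hFsub) hF hFpos hFlt.le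
    have hsymm : F \ Ω ⊆ symmDiff (Ωs j) Ω := fun x hx => Or.inl ⟨hFsub hx.1, hx.2⟩
    obtain ⟨hI, hIle⟩ := H F Ω hFm hΩm hF hΩper (by linarith) (by
      refine (measure_mono ?_).trans_lt hj1
      rintro x (⟨hx | hx, hx'⟩ | ⟨hx, hx'⟩)
      exacts [hsymm ⟨hx, hx'⟩, absurd hx hx', absurd (Or.inr hx) hx'])
    have hvol := volume_real_le_inter_add hε.le hsymm hj2.le
    have hIv : volume (F ∩ Ω) ≠ ⊤ := measure_ne_top_of_subset inter_subset_left hFv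
    have hlow : η * volume.real (F ∩ Ω) ≤ (perimeter (F ∩ Ω)).toReal := by
      rcases (measureReal_nonneg : 0 ≤ volume.real (F ∩ Ω)).eq_or_lt with h0 | h0
      · rw [← h0, mul_zero]
        exact ENNReal.toReal_nonneg
      · have := cheegerConstant_le_ofReal (hFm.inter hΩm) inter_subset_right hI hIv h0
          (a := (perimeter (F ∩ Ω)).toReal / volume.real (F ∩ Ω))
          (by rw [div_mul_cancel₀ _ h0.ne'])
        have := ENNReal.toReal_le_of_le_ofReal (by positivity) this
        rwa [le_div_iff₀ h0] at this
    have hεeq : ε * (1 + η) = (η - β) * c / 2 := by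
      rw [hεdef]
      field_simp
    have h1 : η * volume.real F ≤ η * volume.real (F ∩ Ω) + η * ε := by
      rw [← mul_add]
      exact mul_le_mul_of_nonneg_left hvol hη0.le
    have h2 : (η - β) * c ≤ (η - β) * volume.real F :=
      mul_le_mul_of_nonneg_left hcF (sub_pos.2 hβη).le
    have h3 : 0 < (η - β) * c := mul_pos (sub_pos.2 hβη) hc
    linarith
  · obtain ⟨b, hhb, hba⟩ := exists_between ha
    have hbfin : b ≠ ⊤ := hba.ne_top
    set β := b.toReal with hβ
    have hbβ : ENNReal.ofReal β = b := ENNReal.ofReal_toReal hbfin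
    obtain ⟨F, hFsub, hFm, hF, hFv, hFpos, hFlt⟩ :=
      exists_of_cheegerConstant_lt hΩbd (a := β) (by rwa [hbβ])
    have hβ0 : 0 ≤ β := ENNReal.toReal_nonneg
    set gap := β * volume.real F - (perimeter F).toReal with hgap
    have hgap0 : 0 < gap := sub_pos.2 hFlt
    set ε := min (gap / (1 + β)) (volume.real F / 2) with hεdef
    have hε : 0 < ε := lt_min (by positivity) (by positivity)
    obtain ⟨δ, hδ, H⟩ := exists_perimeter_inter_le_add hΩm hε
    filter_upwards [hsmall δ hδ, hsmall ε hε, hPreal _ (half_pos hε)] with j hj1 hj2 hj3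
    refine lt_of_le_of_lt ?_ hba
    rw [← hbβ]
    obtain ⟨hI, hIle⟩ := H F (Ωs j) hFm (hm j) hF (hper j) hj3 (by
      refine (measure_mono ?_).trans_lt hj1
      rintro x (⟨hx | hx, hx'⟩ | ⟨hx, hx'⟩)
      exacts [absurd (hFsub hx) hx', Or.inl ⟨hx, hx'⟩, Or.inr ⟨hx, fun h => hx' (Or.inr h)⟩])
    have hvol := volume_real_le_inter_add (U := Ωs j) hε.le
      (fun x hx => Or.inr ⟨hFsub hx.1, hx.2⟩) hj2.le
    have hIv : volume (F ∩ Ωs j) ≠ ⊤ := measure_ne_top_of_subset inter_subset_left hFv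
    have hε2 : ε ≤ volume.real F / 2 := min_le_right _ _
    have hε1 : ε * (1 + β) ≤ gap := by
      rw [← le_div_iff₀ (by positivity)]
      exact min_le_left _ _
    refine cheegerConstant_le_ofReal (hFm.inter (hm j)) inter_subset_right hI hIv (by linarith) ?_
    have h1 : β * volume.real F ≤ β * volume.real (F ∩ Ωs j) + β * ε := by
      rw [← mul_add]
      exact mul_le_mul_of_nonneg_left hvol hβ0
    linarith
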